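/- arXiv:2301.12941 — 2 statements merged into one kernel-verified Lean document; each statement's English description precedes it below -/
import Mathlib

section
/- For every α > 0 and every k > 0, the improper integral ∫ from 0 to ∞ of sin(k·ρ)·erfc(α·ρ) dρ converges and equals (1 − exp(−k²/(4α²)))/k. -/
open Real MeasureTheory

/-- The error function `erf z = (2/√π)·∫₀ᶻ exp(−t²) dt`. -/
noncomputable def erf (z : ℝ) : ℝ := (2 / Real.sqrt π) * ∫ t in (0:ℝ)..z, Real.exp (-t^2)

/-- The complementary error function `erfc z = 1 − erf z`. -/
noncomputable def erfc (z : ℝ) : ℝ := 1 - erf z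

open Filter Topology Set in
lemma erfc_eq_aux (z : ℝ) : erfc z = (2 / Real.sqrt π) * ∫ t in Ioi z, Real.exp (-t^2) := by
  have hi : Integrable (fun t : ℝ => Real.exp (-t^2)) := by
    simpa using integrable_exp_neg_mul_sq (b := 1) one_pos
  have h0 : ∫ t in Ioi (0:ℝ), Real.exp (-t^2) = Real.sqrt π / 2 := by
    simpa using integral_gaussian_Ioi 1
  have h1 := intervalIntegral.integral_Ioi_sub_Ioi' (f := fun t : ℝ => Real.exp (-t^2))
    (μ := volume) (a := 0) (b := z) hi.integrableOn hi.integrableOn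
  have hp : Real.sqrt π ≠ 0 := by positivity
  unfold erfc erf
  rw [← h1, h0]
  field_simp
  ring

open Filter Topology Set in
lemma erfc_nonneg_aux (z : ℝ) : 0 ≤ erfc z := by
  rw [erfc_eq_aux]
  exact mul_nonneg (by positivity) (integral_nonneg fun t => (Real.exp_pos _).le)

open Filter Topology Set in
lemma erfc_le_aux (z : ℝ) :
    erfc z ≤ (2 / Real.sqrt π * Real.exp (1/4)) * Real.exp (-z) := by
  have hi : Integrable (fun t : ℝ => Real.exp (-t^2)) := by
    simpa using integrable_exp_neg_mul_sq (b := 1) one_pos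
  have hj : IntegrableOn (fun t : ℝ => Real.exp (1/4) * Real.exp (-t)) (Ioi z) :=
    (integrableOn_exp_neg_Ioi z).const_mul _
  rw [erfc_eq_aux, mul_assoc]
  gcongr
  rw [← integral_exp_neg_Ioi z, ← integral_const_mul]
  refine integral_mono hi.integrableOn hj fun t => ?_
  simp only
  rw [← Real.exp_add]
  apply Real.exp_le_exp.2
  nlinarith [sq_nonneg (t - 1/2)]

lemma erfc_hasDeriv_aux (α x : ℝ) :
    HasDerivAt (fun ρ => erfc (α * ρ)) (-(2 / Real.sqrt π * (α * Real.exp (-α^2 * x^2)))) x := by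
  have hc : Continuous (fun t : ℝ => Real.exp (-t^2)) := by fun_prop
  have h1 : HasDerivAt erfc (-(2 / Real.sqrt π * Real.exp (-(α * x)^2))) (α * x) := by
    have := ((hc.integral_hasStrictDerivAt 0 (α * x)).hasDerivAt.const_mul
      (2 / Real.sqrt π)).const_sub 1
    exact this
  have h2 : HasDerivAt (fun ρ : ℝ => α * ρ) α x := by
    simpa using (hasDerivAt_id x).const_mul α
  have h3 := h1.comp x h2
  refine HasDerivAt.congr_deriv (f := fun ρ => erfc (α * ρ)) h3 ?_
  rw [show -(α * x)^2 = -α^2 * x^2 by ring]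
  ring

lemma cos_gauss_aux (b k : ℝ) (hb : 0 < b) :
    Integrable (fun x : ℝ => Real.cos (k * x) * Real.exp (-b * x^2)) ∧
    ∫ x in Set.Ioi (0:ℝ), Real.cos (k * x) * Real.exp (-b * x^2)
      = Real.sqrt (π / b) / 2 * Real.exp (-k^2 / (4 * b)) := by
  have hi : Integrable (fun x : ℝ => Real.cos (k * x) * Real.exp (-b * x^2)) := by
    refine (integrable_exp_neg_mul_sq hb).bdd_mul (c := 1) (by fun_prop) ?_
    exact Filter.Eventually.of_forall fun x => by
      simpa using Real.abs_cos_le_one (k * x)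
  refine ⟨hi, ?_⟩
  have hF := fourierIntegral_gaussian (b := (b:ℂ)) (by simpa using hb) (k : ℂ)
  have hint : Integrable (fun x : ℝ => Complex.exp (Complex.I * k * x) * Complex.exp (-b * x^2)) := by
    have h := (integrable_cexp_neg_mul_sq (b := (b:ℂ)) (by simpa using hb))
    refine h.bdd_mul (c := 1) (by fun_prop) ?_
    exact Filter.Eventually.of_forall fun x => by
      rw [show Complex.I * k * x = ((k * x : ℝ) : ℂ) * Complex.I by push_cast; ring]
      rw [Complex.norm_exp_ofReal_mul_I]
  have hre := congrArg Complex.re hF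
  have h1 := integral_re hint
  simp only [RCLike.re_eq_complex_re] at h1
  rw [← h1] at hre
  have h2 : ∀ x : ℝ, (Complex.exp (Complex.I * k * x) * Complex.exp (-b * x^2)).re
      = Real.cos (k * x) * Real.exp (-b * x^2) := by
    intro x
    rw [show Complex.I * k * x = ((k * x : ℝ) : ℂ) * Complex.I by push_cast; ring,
      show (-b * x^2 : ℂ) = ((-b * x^2 : ℝ) : ℂ) by push_cast; ring, ← Complex.ofReal_exp,
      Complex.re_mul_ofReal, Complex.exp_ofReal_mul_I_re]
  have h3 : (((π:ℂ) / b) ^ (1 / 2 : ℂ) * Complex.exp (-(k:ℂ)^2 / (4 * b)))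
      = ((Real.sqrt (π / b) * Real.exp (-k^2 / (4 * b)) : ℝ) : ℂ) := by
    rw [Real.sqrt_eq_rpow]
    push_cast [Complex.ofReal_cpow (show 0 ≤ π / b by positivity)]
    rfl
  rw [h3, Complex.ofReal_re] at hre
  simp_rw [h2] at hre
  have h4 := integral_comp_abs (f := fun x : ℝ => Real.cos (k * x) * Real.exp (-b * x^2))
  have h5 : ∀ x : ℝ, Real.cos (k * |x|) * Real.exp (-b * |x|^2)
      = Real.cos (k * x) * Real.exp (-b * x^2) := by
    intro x
    rw [sq_abs]
    rcases abs_choice x with h | h <;> rw [h]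
    rw [mul_neg, Real.cos_neg]
  simp_rw [h5] at h4
  linarith

/-- For every `α > 0` and `k > 0`, the improper integral
`∫₀^∞ sin(k·ρ)·erfc(α·ρ) dρ` converges and equals `(1 − exp(−k²/(4α²)))/k`. -/
theorem stmt_5 (α k : ℝ) (hα : 0 < α) (hk : 0 < k) :
    IntegrableOn (fun ρ : ℝ => Real.sin (k * ρ) * erfc (α * ρ)) (Set.Ioi 0) ∧
    ∫ ρ in Set.Ioi (0:ℝ), Real.sin (k * ρ) * erfc (α * ρ)
      = (1 - Real.exp (-k^2 / (4 * α^2))) / k := by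
  have hE : IntegrableOn (fun ρ : ℝ => Real.exp (-α * ρ)) (Set.Ioi 0) :=
    integrableOn_exp_mul_Ioi (by linarith) 0
  have hcont : Continuous (fun ρ => erfc (α * ρ)) :=
    continuous_iff_continuousAt.2 fun x => (erfc_hasDeriv_aux α x).continuousAt
  have hI : IntegrableOn (fun ρ : ℝ => Real.sin (k * ρ) * erfc (α * ρ)) (Set.Ioi 0) := by
    refine (hE.const_mul (2 / Real.sqrt π * Real.exp (1/4))).mono'
      (by fun_prop) (Filter.Eventually.of_forall fun ρ => ?_)
    rw [norm_mul, Real.norm_eq_abs, Real.norm_eq_abs, abs_of_nonneg (erfc_nonneg_aux _)]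
    have h := erfc_le_aux (α * ρ)
    rw [← neg_mul] at h
    refine le_trans ?_ h
    exact mul_le_of_le_one_left (erfc_nonneg_aux _) (Real.abs_sin_le_one _)
  refine ⟨hI, ?_⟩
  have hb : 0 < α^2 := by positivity
  obtain ⟨hc1, hc2⟩ := cos_gauss_aux (α^2) k hb
  have hg1 := integrable_exp_neg_mul_sq hb
  have hg2 := integral_gaussian_Ioi (α^2)
  set D : ℝ → ℝ := fun x => 2 * α / (k * Real.sqrt π) *
    (Real.exp (-α^2 * x^2) - Real.cos (k * x) * Real.exp (-α^2 * x^2)) with hD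
  have hDi : IntegrableOn D (Set.Ioi 0) := ((hg1.sub hc1).const_mul _).integrableOn
  have hsp : Real.sqrt π ≠ 0 := by positivity
  have hderiv : ∀ x ∈ Set.Ici (0:ℝ),
      HasDerivAt (fun ρ => (1 - Real.cos (k * ρ)) / k * erfc (α * ρ))
        (Real.sin (k * x) * erfc (α * x) - D x) x := by
    intro x _
    have h2 : HasDerivAt (fun ρ : ℝ => k * ρ) k x := by
      simpa using (hasDerivAt_id x).const_mul k
    have h3 := ((h2.cos.const_sub 1).div_const k).mul (erfc_hasDeriv_aux α x)
    refine HasDerivAt.congr_deriv (f := fun ρ => (1 - Real.cos (k * ρ)) / k * erfc (α * ρ)) h3 ?_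
    simp only [hD]
    field_simp
    ring
  have hlim : Filter.Tendsto (fun ρ => (1 - Real.cos (k * ρ)) / k * erfc (α * ρ))
      Filter.atTop (nhds 0) := by
    have hz : Filter.Tendsto (fun ρ : ℝ => 2 / k * ((2 / Real.sqrt π * Real.exp (1/4)) *
        Real.exp (-(α * ρ)))) Filter.atTop (nhds 0) := by
      have := (Real.tendsto_exp_neg_atTop_nhds_zero.comp
        (Filter.tendsto_id.const_mul_atTop hα)).const_mul (2 / Real.sqrt π * Real.exp (1/4))
      simpa using this.const_mul (2 / k)
    refine squeeze_zero (fun ρ => ?_) (fun ρ => ?_) hz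
    · exact mul_nonneg (div_nonneg (by linarith [Real.cos_le_one (k * ρ)]) hk.le)
        (erfc_nonneg_aux _)
    · refine mul_le_mul ?_ (erfc_le_aux _) (erfc_nonneg_aux _) (by positivity)
      gcongr
      linarith [Real.neg_one_le_cos (k * ρ)]
  have hmain := integral_Ioi_of_hasDerivAt_of_tendsto' hderiv (hI.sub hDi) hlim
  rw [integral_sub hI hDi] at hmain
  have hDint : ∫ x in Set.Ioi (0:ℝ), D x = (1 - Real.exp (-k^2 / (4 * α^2))) / k := by
    simp only [hD]
    rw [integral_const_mul, integral_sub hg1.integrableOn hc1.integrableOn, hg2, hc2,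
      Real.sqrt_div Real.pi_pos.le, Real.sqrt_sq hα.le]
    field_simp
  rw [hDint] at hmain
  simp at hmain
  linarith
end

section
/- Fix N ≥ 1, charges q : Fin N → ℝ, constants k_e > 0 and α > 0, a map L : ℤ³ → ℝ³ (the lattice translations L_n = n1·l1 + n2·l2 + n3·l3), and a finite set 𝒩 ⊆ ℤ³. For ion positions R : Fin N → ℝ³ write r_{i,j,n} = R(i) + L(n) − R(j), and call a triple (i, j, n) admissible if n ∈ 𝒩 and (i ≠ j or n ≠ 0). Define the short-range Coulomb energy Φ^S(R) = (k_e/2)·Σ over admissible (i,j,n) of q(i)·q(j)·erfc(α·‖r_{i,j,n}‖)/‖r_{i,j,n}‖. If r_{i,j,n} ≠ 0 for every admissible triple, then Φ^S is differentiable in each position and for each t ∈ Fin N the gradient of Φ^S with respect to R(t) equals (k_e/2)·Σ_{n ∈ 𝒩} [ −Σ over j with (t,j,n) admissible of q(t)·q(j)·((2α/√π)·exp(−α²·‖r_{t,j,n}‖²) + erfc(α·‖r_{t,j,n}‖)/‖r_{t,j,n}‖)·r_{t,j,n}/‖r_{t,j,n}‖² + Σ over i with (i,t,n) admissible of q(i)·q(t)·((2α/√π)·exp(−α²·‖r_{i,t,n}‖²)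 + erfc(α·‖r_{i,t,n}‖)/‖r_{i,t,n}‖)·r_{i,t,n}/‖r_{i,t,n}‖² ]. -/
open Real Finset

lemma hasDerivAt_erfc_aux (z : ℝ) :
    HasDerivAt erfc (-((2 / Real.sqrt π) * Real.exp (-z^2))) z := by
  unfold erfc erf
  have hc : Continuous (fun t : ℝ => Real.exp (-t^2)) := by fun_prop
  have h := (intervalIntegral.integral_hasDerivAt_right (hc.intervalIntegrable 0 z)
    (hc.stronglyMeasurableAtFilter _ _) hc.continuousAt)
  exact (h.const_mul (2 / Real.sqrt π)).const_sub 1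

lemma hasGradientAt_pair_aux {E : Type*} [NormedAddCommGroup E] [InnerProductSpace ℝ E] [CompleteSpace E]
    (α : ℝ) (v : E) (hv : v ≠ 0) :
    HasGradientAt (fun w : E => erfc (α * ‖w‖) / ‖w‖)
      ((-(((2 * α / Real.sqrt π) * Real.exp (-(α^2) * ‖v‖^2)
                  + erfc (α * ‖v‖) / ‖v‖) / ‖v‖^2)) • v) v := by
  have hn : ‖v‖ ≠ 0 := norm_ne_zero_iff.mpr hv
  have hnorm : HasFDerivAt (fun w : E => ‖w‖)
      ((‖v‖⁻¹) • innerSL ℝ v) v := by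
    have h1 := (hasStrictFDerivAt_norm_sq v).hasFDerivAt.sqrt (pow_ne_zero 2 hn)
    have h2 : (fun w : E => Real.sqrt (‖w‖^2)) = fun w => ‖w‖ := by
      funext w; exact Real.sqrt_sq (norm_nonneg w)
    rw [h2] at h1
    refine h1.congr_fderiv ?_
    rw [Real.sqrt_sq (norm_nonneg v)]
    ext w
    simp
    field_simp
  have h1 : HasDerivAt (fun s : ℝ => erfc (α * s) / s)
      (-(((2 * α / Real.sqrt π) * Real.exp (-(α^2) * ‖v‖^2)
                  + erfc (α * ‖v‖) / ‖v‖) / ‖v‖)) ‖v‖ := by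
    have ha : HasDerivAt (fun s : ℝ => α * s) α ‖v‖ := by
      simpa using (hasDerivAt_id ‖v‖).const_mul α
    have hb := (hasDerivAt_erfc_aux (α * ‖v‖)).comp ‖v‖ ha
    have hc := hb.div (hasDerivAt_id ‖v‖) hn
    refine hc.congr_deriv ?_
    have he : Real.exp (-(α * ‖v‖)^2) = Real.exp (-(α^2) * ‖v‖^2) := by
      congr 1; ring
    simp only [id, Function.comp, he]
    field_simp
    ring
  rw [hasGradientAt_iff_hasFDerivAt]
  have h2 := h1.comp_hasFDerivAt v hnorm
  refine h2.congr_fderiv ?_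
  ext w
  simp [inner_smul_left]
  field_simp

theorem stmt_8_aux {E : Type*} [NormedAddCommGroup E] [InnerProductSpace ℝ E] [CompleteSpace E]
    (N : ℕ) (hN : 1 ≤ N) (q : Fin N → ℝ) (k_e α : ℝ)
    (hke : 0 < k_e) (hα : 0 < α)
    (L : ℤ × ℤ × ℤ → E) (𝒩 : Finset (ℤ × ℤ × ℤ))
    (R : Fin N → E)
    (r : (Fin N → E) → Fin N → Fin N → ℤ × ℤ × ℤ →
      E)
    (hr : ∀ R' i j n, r R' i j n = R' i + L n - R' j)
    (ΦS : (Fin N → E) → ℝ)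
    (hΦS : ∀ R', ΦS R' = (k_e / 2) * ∑ i : Fin N, ∑ j : Fin N, ∑ n ∈ 𝒩,
      (if i ≠ j ∨ n ≠ 0 then
        q i * q j * erfc (α * ‖r R' i j n‖) / ‖r R' i j n‖ else 0))
    (hnz : ∀ i j n, n ∈ 𝒩 → (i ≠ j ∨ n ≠ 0) → r R i j n ≠ 0) :
    ∀ t : Fin N,
      HasGradientAt (fun x => ΦS (Function.update R t x))
        ((k_e / 2) • ∑ n ∈ 𝒩,
          ((∑ j : Fin N, if t ≠ j ∨ n ≠ 0 then
              (-(q t * q j * ((2 * α / Real.sqrt π) * Real.exp (-(α^2) * ‖r R t j n‖^2)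
                  + erfc (α * ‖r R t j n‖) / ‖r R t j n‖) / ‖r R t j n‖^2)) • r R t j n
            else 0)
          + ∑ i : Fin N, if i ≠ t ∨ n ≠ 0 then
              (q i * q t * ((2 * α / Real.sqrt π) * Real.exp (-(α^2) * ‖r R i t n‖^2)
                  + erfc (α * ‖r R i t n‖) / ‖r R i t n‖) / ‖r R i t n‖^2) • r R i t n
            else 0))
        (R t) := by
  intro t
  set g : E → E := fun v =>
    (-(((2 * α / Real.sqrt π) * Real.exp (-(α^2) * ‖v‖^2)
                  + erfc (α * ‖v‖) / ‖v‖) / ‖v‖^2)) • v with hg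
  let a : Fin N → ℝ := fun i => if i = t then 1 else 0
  have hup : ∀ i, HasFDerivAt (fun x => Function.update R t x i)
      (a i • ContinuousLinearMap.id ℝ (E)) (R t) := by
    intro i
    by_cases h : i = t
    · subst h
      simp only [a, Function.update_self, if_true, one_smul]
      exact hasFDerivAt_id (R i)
    · simp only [a, Function.update_of_ne h, if_neg h, zero_smul]
      exact hasFDerivAt_const (R i) (R t)
  have hrd : ∀ i j n, HasFDerivAt (fun x => r (Function.update R t x) i j n)
      ((a i - a j) • ContinuousLinearMap.id ℝ (E)) (R t) := by
    intro i j n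
    simp only [hr]
    rw [sub_smul]
    exact ((hup i).add_const (L n)).sub (hup j)
  have hterm : ∀ i j, ∀ n ∈ 𝒩, HasFDerivAt (fun x =>
      (if i ≠ j ∨ n ≠ 0 then q i * q j * erfc (α * ‖r (Function.update R t x) i j n‖)
        / ‖r (Function.update R t x) i j n‖ else 0))
      (InnerProductSpace.toDual ℝ _ (if i ≠ j ∨ n ≠ 0 then
        ((a i - a j) * (q i * q j)) • g (r R i j n) else 0)) (R t) := by
    intro i j n hn
    by_cases h : i ≠ j ∨ n ≠ 0
    · simp only [if_pos h]
      have h0 := hasGradientAt_pair_aux α (r R i j n) (hnz i j n hn h)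
      rw [hasGradientAt_iff_hasFDerivAt] at h0
      have hR : r R i j n = r (Function.update R t (R t)) i j n := by
        rw [Function.update_eq_self]
      have h1 := h0
      rw [hR] at h1
      have h2 := (HasFDerivAt.comp (R t) h1 (hrd i j n)).const_mul (q i * q j)
      simp only [mul_div_assoc]
      refine h2.congr_fderiv ?_
      rw [← hR]
      ext w
      simp [hg, inner_smul_left]
      try ring
    · simp only [if_neg h, map_zero]
      exact hasFDerivAt_const _ _
  have hsum := (HasFDerivAt.fun_sum (u := Finset.univ) fun i _ =>
    HasFDerivAt.fun_sum (u := Finset.univ) fun j _ =>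
    HasFDerivAt.fun_sum (u := 𝒩) fun n hn => hterm i j n hn).const_mul (k_e / 2)
  rw [hasGradientAt_iff_hasFDerivAt]
  simp only [hΦS]
  refine hsum.congr_fderiv ?_
  symm
  simp only [← map_sum]
  rw [LinearIsometryEquiv.map_smul]
  congr 2
  have hsplit : ∀ i j n, (if i ≠ j ∨ n ≠ 0 then
        ((a i - a j) * (q i * q j)) • g (r R i j n) else 0)
      = (if i = t then (if i ≠ j ∨ n ≠ 0 then (q i * q j) • g (r R i j n) else 0) else 0)
       + (if j = t then (if i ≠ j ∨ n ≠ 0 then (-(q i * q j)) • g (r R i j n) else 0) else 0) := by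
    intro i j n
    by_cases h : i ≠ j ∨ n ≠ 0
    · simp only [if_pos h, sub_mul, sub_smul, a]
      split_ifs <;> simp
    · simp only [if_neg h]; simp
  simp only [hsplit]
  have hcomm : ∀ F : Fin N → Fin N → ℤ × ℤ × ℤ → E,
      ∑ i, ∑ j, ∑ n ∈ 𝒩, F i j n = ∑ n ∈ 𝒩, ∑ i, ∑ j, F i j n := by
    intro F
    rw [Finset.sum_comm]
    rw [Finset.sum_congr rfl fun j _ => Finset.sum_comm, Finset.sum_comm]
    exact Finset.sum_congr rfl fun n _ => Finset.sum_comm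
  rw [hcomm]
  refine Finset.sum_congr rfl fun n _ => ?_
  simp only [Finset.sum_add_distrib]
  congr 1
  · rw [Finset.sum_comm]
    simp only [Finset.sum_ite_eq', Finset.mem_univ, if_true]
    refine Finset.sum_congr rfl fun j _ => ?_
    congr 1
    simp only [hg, smul_smul]
    congr 1; ring
  · simp only [Finset.sum_ite_eq', Finset.mem_univ, if_true]
    refine Finset.sum_congr rfl fun j _ => ?_
    congr 1
    simp only [hg, smul_smul]
    congr 1; ring

/-- **Internal Coulomb forces (short-range Ewald part).** With
`r_{i,j,n} = R(i) + L(n) − R(j)`, a triple `(i,j,n)` admissible when `n ∈ 𝒩` and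
(`i ≠ j` or `n ≠ 0`), and
`Φ^S(R) = (k_e/2)·Σ_{admissible} q_i·q_j·erfc(α‖r_{i,j,n}‖)/‖r_{i,j,n}‖`,
if `r_{i,j,n} ≠ 0` for every admissible triple then `Φ^S` is differentiable in
each position, with the gradient with respect to `R(t)` as displayed. -/
theorem stmt_8 (N : ℕ) (hN : 1 ≤ N) (q : Fin N → ℝ) (k_e α : ℝ)
    (hke : 0 < k_e) (hα : 0 < α)
    (L : ℤ × ℤ × ℤ → EuclideanSpace ℝ (Fin 3)) (𝒩 : Finset (ℤ × ℤ × ℤ))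
    (R : Fin N → EuclideanSpace ℝ (Fin 3))
    (r : (Fin N → EuclideanSpace ℝ (Fin 3)) → Fin N → Fin N → ℤ × ℤ × ℤ →
      EuclideanSpace ℝ (Fin 3))
    (hr : ∀ R' i j n, r R' i j n = R' i + L n - R' j)
    (ΦS : (Fin N → EuclideanSpace ℝ (Fin 3)) → ℝ)
    (hΦS : ∀ R', ΦS R' = (k_e / 2) * ∑ i : Fin N, ∑ j : Fin N, ∑ n ∈ 𝒩,
      (if i ≠ j ∨ n ≠ 0 then
        q i * q j * erfc (α * ‖r R' i j n‖) / ‖r R' i j n‖ else 0))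
    (hnz : ∀ i j n, n ∈ 𝒩 → (i ≠ j ∨ n ≠ 0) → r R i j n ≠ 0) :
    ∀ t : Fin N,
      HasGradientAt (fun x => ΦS (Function.update R t x))
        ((k_e / 2) • ∑ n ∈ 𝒩,
          ((∑ j : Fin N, if t ≠ j ∨ n ≠ 0 then
              (-(q t * q j * ((2 * α / Real.sqrt π) * Real.exp (-(α^2) * ‖r R t j n‖^2)
                  + erfc (α * ‖r R t j n‖) / ‖r R t j n‖) / ‖r R t j n‖^2)) • r R t j n
            else 0)
          + ∑ i : Fin N, if i ≠ t ∨ n ≠ 0 then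
              (q i * q t * ((2 * α / Real.sqrt π) * Real.exp (-(α^2) * ‖r R i t n‖^2)
                  + erfc (α * ‖r R i t n‖) / ‖r R i t n‖) / ‖r R i t n‖^2) • r R i t n
            else 0))
        (R t) := by
  exact stmt_8_aux N hN q k_e α hke hα L 𝒩 R r hr ΦS hΦS hnz
end
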